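/- Suppose there is a sequence of parameters θ^(1), θ^(2), … ∈ ℝ^q such that lim_{k→∞} |û(x_j, θ^(k)) − u(x_j)| = 0 for every sensor index j ∈ {1,…,r}. If ε > 0, L_u + L_û > 0, and the sensors are distributed so that Δ < ε / (2(L_u + L_û)), then there exists K ∈ ℕ such that for every k > K, sup_{x∈Ω} |û(x, θ^(k)) − u(x)| < ε. -/

import Mathlib

/-- Every point of a bounded set lies within the fill distance of some sensor. -/
lemma exists_norm_sub_le_iSup_iInf {E ι : Type*} [SeminormedAddCommGroup E] [Finite ι]
    [Nonempty ι] {Ω : Set E} (hbdd : Bornology.IsBounded Ω) {xs : ι → E}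
    (hxs : ∀ j, xs j ∈ Ω) (x : Ω) :
    ∃ j, ‖(x : E) - xs j‖ ≤ ⨆ y : Ω, ⨅ j, ‖(y : E) - xs j‖ := by
  obtain ⟨j, hj⟩ := exists_eq_ciInf_of_finite (f := fun j => ‖(x : E) - xs j‖)
  have hbelow (y : Ω) : BddBelow (Set.range fun j => ‖(y : E) - xs j‖) :=
    ⟨0, by rintro _ ⟨i, rfl⟩; exact norm_nonneg _⟩
  have habove : BddAbove (Set.range fun y : Ω => ⨅ j, ‖(y : E) - xs j‖) := by
    refine ⟨Metric.diam Ω, ?_⟩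
    rintro _ ⟨y, rfl⟩
    refine (ciInf_le (hbelow y) j).trans ?_
    rw [← dist_eq_norm]
    exact Metric.dist_le_diam_of_mem hbdd y.2 (hxs j)
  exact ⟨j, hj.le.trans (le_ciSup habove x)⟩

/-- Uniform convergence of the data-assimilated shape-morphing solution
(Theorem 1 of the paper): if the approximation converges at each sensor and
the sensors are dense enough, `û` converges uniformly to `u` on `Ω`. -/
theorem uniform_convergence_DA_SMS {n q r : ℕ} (hr : 0 < r)
    (Ω : Set (EuclideanSpace ℝ (Fin n))) (hΩ : Ω.Nonempty)
    (hbdd : Bornology.IsBounded Ω)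
    (xs : Fin r → EuclideanSpace ℝ (Fin n)) (hxs : ∀ j, xs j ∈ Ω)
    (u : EuclideanSpace ℝ (Fin n) → ℝ)
    (uhat : EuclideanSpace ℝ (Fin n) → (Fin q → ℝ) → ℝ)
    (Lu Luhat : ℝ)
    (hu : ∀ x ∈ Ω, ∀ y ∈ Ω, |u x - u y| ≤ Lu * ‖x - y‖)
    (huhat : ∀ θ : Fin q → ℝ, ∀ x ∈ Ω, ∀ y ∈ Ω,
      |uhat x θ - uhat y θ| ≤ Luhat * ‖x - y‖)
    (Δ : ℝ)
    (hΔ : Δ = ⨆ x : Ω, ⨅ j : Fin r, ‖(x : EuclideanSpace ℝ (Fin n)) - xs j‖)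
    (θs : ℕ → (Fin q → ℝ))
    (hconv : ∀ j : Fin r,
      Filter.Tendsto (fun k => |uhat (xs j) (θs k) - u (xs j)|) Filter.atTop (nhds 0))
    (ε : ℝ) (hε : 0 < ε) (hL : 0 < Lu + Luhat)
    (hsens : Δ < ε / (2 * (Lu + Luhat))) :
    ∃ K : ℕ, ∀ k > K,
      (⨆ x : Ω, |uhat (x : EuclideanSpace ℝ (Fin n)) (θs k) - u x|) < ε := by
  have : Nonempty (Fin r) := ⟨⟨0, hr⟩⟩
  have : Nonempty Ω := hΩ.to_subtype
  have hev : ∀ᶠ k in Filter.atTop, ∀ j, |uhat (xs j) (θs k) - u (xs j)| < ε / 4 :=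
    Filter.eventually_all.2 fun j => (hconv j).eventually_lt_const (by positivity)
  obtain ⟨K, hK⟩ := Filter.eventually_atTop.1 hev
  refine ⟨K, fun k hk => ?_⟩
  refine (ciSup_le fun x => ?_ : _ ≤ 3 * ε / 4).trans_lt (by linarith)
  obtain ⟨j, hj⟩ := exists_norm_sub_le_iSup_iInf hbdd hxs x
  rw [← hΔ] at hj
  have hdist : (Lu + Luhat) * ‖(x : EuclideanSpace ℝ (Fin n)) - xs j‖ < ε / 2 := by
    have := (lt_div_iff₀ (by positivity)).1 (hj.trans_lt hsens)
    linarith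
  have hsensor := abs_lt.1 (hK k hk.le j)
  have hux := abs_le.1 (hu x x.2 (xs j) (hxs j))
  have huhatx := abs_le.1 (huhat (θs k) x x.2 (xs j) (hxs j))
  rw [abs_le]
  constructor <;> linarith [hsensor.1, hsensor.2, hux.1, hux.2, huhatx.1, huhatx.2]
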